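/- arXiv:2603.11301 — 2 statements merged into one kernel-verified Lean document; each statement's English description precedes it below -/
import Mathlib

section
/- For every α ∈ (0,1/2), all f, f₀ ∈ 𝒲₁, and all x ∈ ℝ, one has |ℜ_α(f)(x) − ℜ_α(f₀)(x)| ≤ (10 c_{0,α}/(1−2α)²)·‖f−f₀‖_{L∞}·|x|^{1−2α}; consequently the map ℜ_α : 𝒲₁ → 𝒲₁ is continuous with respect to the sup-norm. -/
open Real MeasureTheory Set Filter BoundedContinuousFunction

noncomputable section

namespace GSQGhalfplane

/-- The constant `c_{0,α} = 2^{2α-1} Γ(1+α) / (π Γ(1-α))`. -/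
def C0 (α : ℝ) : ℝ := (2:ℝ) ^ (2*α - 1) * Real.Gamma (1 + α) / (π * Real.Gamma (1 - α))

/-- The constant `c'''_{0,α}`. -/
def C3 (α : ℝ) : ℝ :=
  ((4:ℝ) ^ (1 + α) - 4 + α - 4*α^3) * Real.Gamma α /
    (2*π*α*(5 - 2*α)*(3 - 2*α)*(1 - 2*α)*Real.Gamma (2 - α))

/-- The exponent `δ_u = c'''_{0,α} t₀^{1/2-α} / (1 + c'''_{0,α} t₀^{1/2-α})`. -/
def deltaU (α t0 : ℝ) : ℝ :=
  C3 α * t0 ^ (1/2 - α) / (1 + C3 α * t0 ^ (1/2 - α))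

/-- The lower barrier `f_l(x) = (1 + t₀^{-2} x²)^{-δ_l}`. -/
def fl (t0 δl x : ℝ) : ℝ := (1 + x^2 / t0^2) ^ (-δl)

/-- The upper barrier `f_u(x) = min(1, t₀^{δ_u} |x|^{-δ_u})` (with value `1` at `x = 0`). -/
def fu (α t0 x : ℝ) : ℝ :=
  if x = 0 then 1 else min 1 (t0 ^ deltaU α t0 * |x| ^ (-(deltaU α t0)))

/-- The invariant set `𝒲₁`: even continuous bounded functions with `f(0)=1`,
nonnegative and non-increasing on `[0,∞)`, `x ↦ f(√x)` convex,
`f_l ≤ f ≤ f_u`, and left derivative at `t₀` at most `-t₀^{α-3/2}`. -/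
def W1 (α t0 δl : ℝ) (f : ℝ → ℝ) : Prop :=
  Continuous f ∧ (∃ M : ℝ, ∀ x : ℝ, |f x| ≤ M) ∧ (∀ x : ℝ, f (-x) = f x) ∧
  f 0 = 1 ∧ (∀ x ∈ Ici (0:ℝ), 0 ≤ f x) ∧ AntitoneOn f (Ici (0:ℝ)) ∧
  ConvexOn ℝ (Ici (0:ℝ)) (fun x => f (Real.sqrt x)) ∧
  (∀ x : ℝ, fl t0 δl x ≤ f x) ∧ (∀ x : ℝ, f x ≤ fu α t0 x) ∧
  (∃ d : ℝ, HasDerivWithinAt f d (Iio t0) t0 ∧ d ≤ -(t0 ^ (α - 3/2)))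

/-- The linear operator `𝔗_α(f)`, defined for `x > 0`, set to `0` at `x = 0`,
and extended evenly to `ℝ` (via `|x|`). -/
def Tfr (α : ℝ) (f : ℝ → ℝ) (x : ℝ) : ℝ :=
  if x = 0 then 0
  else (C0 α / α) * ∫ ξ in Ioi (0:ℝ),
    f ξ * (4*α * ξ ^ (-(2*α)) - (ξ / |x|) * (|(|x| - ξ)| ^ (-(2*α)) - (|x| + ξ) ^ (-(2*α))))

/-- The nonlinear map `ℜ_α(f)(x) = exp(-∫₀^{|x|} 𝔗_α(f)(y)/(y(1+𝔗_α(f)(y))) dy)`. -/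
def Rfr (α : ℝ) (f : ℝ → ℝ) (x : ℝ) : ℝ :=
  Real.exp (-(∫ y in (0:ℝ)..|x|, Tfr α f y / (y * (1 + Tfr α f y))))

/-- The functional `𝔟(f) = 4 c_{0,α} ∫₀^∞ f(ξ) ξ^{-2α} dξ`. -/
def bfr (α : ℝ) (f : ℝ → ℝ) : ℝ := 4 * C0 α * ∫ ξ in Ioi (0:ℝ), f ξ * ξ ^ (-(2*α))

/-- The functional `𝔠(f) = (8(1+2α)(1+α)/3) c_{0,α} ∫₀^∞ (1-f(ξ)) ξ^{-2-2α} dξ`. -/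
def cfr (α : ℝ) (f : ℝ → ℝ) : ℝ :=
  (8*(1+2*α)*(1+α)/3) * C0 α * ∫ ξ in Ioi (0:ℝ), (1 - f ξ) * ξ ^ (-2 - 2*α)

/-- The lower bound `b'_α`. -/
def bLow (α t0 δl : ℝ) : ℝ :=
  2 * C0 α * t0 ^ (1 - 2*α) * Real.Gamma (1/2 - α) * Real.Gamma (α + δl - 1/2) /
    Real.Gamma δl

/-- The upper bound `b''_α`. -/
def bHigh (α t0 : ℝ) : ℝ :=
  4 * C0 α * t0 ^ (1 - 2*α) * (1/(1 - 2*α) + 1/(deltaU α t0 + 2*α - 1))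

/-- The upper bound `c''_{0,α}`. -/
def cHigh (α t0 δl : ℝ) : ℝ :=
  C0 α * t0 ^ (-1 - 2*α) * 8 * (1 + α) * Real.Gamma (1/2 - α) *
    Real.Gamma (δl + α + 1/2) / (3 * Real.Gamma δl)

/-- The kernel of `𝔗_α` at `x = 1`. -/
def ker (α s : ℝ) : ℝ :=
  4 * α * s ^ (-(2*α)) - s * (|1 - s| ^ (-(2*α)) - (1 + s) ^ (-(2*α)))

lemma two_mul_le_log_sub_log {u : ℝ} (h0 : 0 ≤ u) (h1 : u < 1) :
    2 * u ≤ Real.log (1 + u) - Real.log (1 - u) := by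
  have h := Real.hasSum_log_sub_log_of_abs_lt_one (abs_lt.2 ⟨by linarith, h1⟩ : |u| < 1)
  have := h.summable.sum_le_tsum {0} (fun i _ => by positivity)
  rw [h.tsum_eq] at this
  simpa using this

lemma two_mul_le_rpow_sub_rpow {a u : ℝ} (ha : 0 < a) (h0 : 0 ≤ u) (h1 : u < 1) :
    2 * a * u ≤ (1 - u) ^ (-a) - (1 + u) ^ (-a) := by
  have hp : 0 < 1 - u := by linarith
  have hq : 0 < 1 + u := by linarith
  set L := Real.log (1 + u)
  set l := Real.log (1 - u)
  have hL : 2 * u ≤ L - l := two_mul_le_log_sub_log h0 h1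
  have hs : a / 2 * (L - l) ≤ Real.sinh (a / 2 * (L - l)) :=
    Real.self_le_sinh_iff.2 (by apply mul_nonneg <;> linarith)
  have hLl : L + l ≤ 0 := by
    rw [← Real.log_mul hq.ne' hp.ne']
    exact Real.log_nonpos (by positivity) (by nlinarith)
  have he : 1 ≤ Real.exp (-(a / 2) * (L + l)) := Real.one_le_exp (by nlinarith)
  have key : (1 - u) ^ (-a) - (1 + u) ^ (-a)
      = Real.exp (-(a / 2) * (L + l)) * (2 * Real.sinh (a / 2 * (L - l))) := by
    rw [Real.rpow_def_of_pos hp, Real.rpow_def_of_pos hq, Real.sinh_eq, mul_div_cancel₀ _ two_ne_zero,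
      mul_sub, ← Real.exp_add, ← Real.exp_add]
    congr 2 <;> ring
  rw [key]
  have h2 : a * u ≤ Real.sinh (a / 2 * (L - l)) := by nlinarith
  have h3 : 0 ≤ a * u := by positivity
  nlinarith

lemma ker_nonpos {α s : ℝ} (hα : 0 < α) (hs : 1 < s) : ker α s ≤ 0 := by
  have hs0 : 0 < s := by linarith
  have hu : s⁻¹ < 1 := inv_lt_one_of_one_lt₀ hs
  have h := two_mul_le_rpow_sub_rpow (a := 2 * α) (by linarith) (inv_pos.2 hs0).le hu
  have e1 : |1 - s| = s * (1 - s⁻¹) := by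
    rw [abs_of_neg (by linarith)]; field_simp; ring
  have e2 : 1 + s = s * (1 + s⁻¹) := by field_simp; ring
  rw [ker, e1, e2, Real.mul_rpow hs0.le (by linarith), Real.mul_rpow hs0.le (by positivity),
    ← mul_sub]
  have hp : 0 < s ^ (-(2 * α)) := by positivity
  have h' := mul_le_mul_of_nonneg_left h (mul_pos hs0 hp).le
  have : s * s ^ (-(2 * α)) * (2 * (2 * α) * s⁻¹) = 4 * α * s ^ (-(2 * α)) := by
    field_simp; ring
  rw [this] at h'
  linarith

lemma rpow_sub_rpow_nonneg {α s : ℝ} (hα : 0 < α) (h0 : 0 ≤ s) (h1 : s < 1) :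
    0 ≤ (1 - s) ^ (-(2*α)) - (1 + s) ^ (-(2*α)) := by
  rw [sub_nonneg]
  exact Real.rpow_le_rpow_of_nonpos (by linarith) (by linarith) (by linarith)

lemma ker_of_lt_one {α s : ℝ} (h1 : s < 1) :
    ker α s = 4 * α * s ^ (-(2*α)) - s * ((1 - s) ^ (-(2*α)) - (1 + s) ^ (-(2*α))) := by
  rw [ker, abs_of_pos (by linarith)]

lemma ker_le {α s : ℝ} (hα : 0 < α) (h0 : 0 < s) (h1 : s < 1) :
    ker α s ≤ 4 * α * s ^ (-(2*α)) := by
  rw [ker_of_lt_one h1]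
  have := mul_nonneg h0.le (rpow_sub_rpow_nonneg hα h0.le h1)
  linarith

lemma ker_antitoneOn {α : ℝ} (hα : 0 < α) : AntitoneOn (ker α) (Ioo 0 1) := by
  rintro s ⟨hs0, hs1⟩ t ⟨ht0, ht1⟩ hst
  rw [ker_of_lt_one hs1, ker_of_lt_one ht1]
  have h1 : t ^ (-(2*α)) ≤ s ^ (-(2*α)) :=
    Real.rpow_le_rpow_of_nonpos hs0 hst (by linarith)
  have h2 : (1 - s) ^ (-(2*α)) ≤ (1 - t) ^ (-(2*α)) :=
    Real.rpow_le_rpow_of_nonpos (by linarith) (by linarith) (by linarith)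
  have h3 : (1 + t) ^ (-(2*α)) ≤ (1 + s) ^ (-(2*α)) :=
    Real.rpow_le_rpow_of_nonpos (by linarith) (by linarith) (by linarith)
  have h4 := mul_le_mul hst (sub_le_sub h2 h3) (rpow_sub_rpow_nonneg hα hs0.le hs1) ht0.le
  nlinarith

lemma two_mul_le_ker {α s : ℝ} (hα : α ∈ Ioo (0:ℝ) (1/2)) (h0 : 0 < s) (h1 : s ≤ α) :
    2 * α * s ^ (-(2*α)) ≤ ker α s := by
  obtain ⟨ha0, ha1⟩ := hα
  rw [ker_of_lt_one (by linarith)]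
  have h2 : (1 - s) ^ (-(2*α)) ≤ 2 := by
    calc (1 - s) ^ (-(2*α)) ≤ (1/2 : ℝ) ^ (-(2*α)) :=
          Real.rpow_le_rpow_of_nonpos (by norm_num) (by linarith) (by linarith)
      _ ≤ (1/2 : ℝ) ^ (-1 : ℝ) :=
          Real.rpow_le_rpow_of_exponent_ge (by norm_num) (by norm_num) (by linarith)
      _ = 2 := by rw [Real.rpow_neg_one]; norm_num
  have h3 : 0 ≤ (1 + s) ^ (-(2*α)) := by positivity
  have h4 : 1 ≤ s ^ (-(2*α)) :=
    Real.one_le_rpow_of_pos_of_le_one_of_nonpos h0 (by linarith) (by linarith)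
  nlinarith

lemma measurable_ker (α : ℝ) : Measurable (ker α) := by
  unfold ker; fun_prop

/-- A primitive of `ker α` on `(1, ∞)`. -/
def kerPrim (α s : ℝ) : ℝ :=
  4 * α / (1 - 2*α) * s ^ (1 - 2*α)
    - ((s - 1) ^ (2 - 2*α) - (s + 1) ^ (2 - 2*α)) / (2 - 2*α)
    - ((s - 1) ^ (1 - 2*α) + (s + 1) ^ (1 - 2*α)) / (1 - 2*α)

/-- A primitive of `ker α` on `(0, 1)`. -/
def kerPrimUnit (α s : ℝ) : ℝ :=
  4 * α / (1 - 2*α) * s ^ (1 - 2*α)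
    - ((1 - s) ^ (2 - 2*α) - (s + 1) ^ (2 - 2*α)) / (2 - 2*α)
    - (-(1 - s) ^ (1 - 2*α) + (s + 1) ^ (1 - 2*α)) / (1 - 2*α)

lemma hasDerivAt_kerPrim {α s : ℝ} (hα : α < 1/2) (hs : 1 < s) :
    HasDerivAt (kerPrim α) (ker α s) s := by
  have hb : 1 - α*2 ≠ 0 := by linarith
  have hc : 1 - α ≠ 0 := by linarith
  have d1 := (hasDerivAt_id' s).rpow_const (p := 1 - 2*α) (Or.inl (by linarith))
  have d2 := ((hasDerivAt_id' s).sub_const 1).rpow_const (p := 2 - 2*α)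
    (Or.inl (by linarith : s - 1 ≠ 0))
  have d3 := ((hasDerivAt_id' s).add_const 1).rpow_const (p := 2 - 2*α)
    (Or.inl (by linarith : s + 1 ≠ 0))
  have d4 := ((hasDerivAt_id' s).sub_const 1).rpow_const (p := 1 - 2*α)
    (Or.inl (by linarith : s - 1 ≠ 0))
  have d5 := ((hasDerivAt_id' s).add_const 1).rpow_const (p := 1 - 2*α)
    (Or.inl (by linarith : s + 1 ≠ 0))
  have d := ((d1.const_mul (4 * α / (1 - 2*α))).sub ((d2.sub d3).div_const (2 - 2*α))).sub
    ((d4.add d5).div_const (1 - 2*α))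
  refine d.congr_deriv ?_
  have e1 : 1 - 2*α - 1 = -(2*α) := by ring
  have e2 : 2 - 2*α - 1 = 1 + -(2*α) := by ring
  rw [e1, e2, Real.rpow_add (by linarith : 0 < s - 1), Real.rpow_add (by linarith : 0 < s + 1),
    Real.rpow_one, Real.rpow_one, ker, abs_of_neg (by linarith), neg_sub, add_comm 1 s]
  field_simp
  ring

lemma hasDerivAt_kerPrimUnit {α s : ℝ} (hα : α < 1/2) (h0 : 0 < s) (hs : s < 1) :
    HasDerivAt (kerPrimUnit α) (ker α s) s := by
  have hb : 1 - α*2 ≠ 0 := by linarith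
  have hc : 1 - α ≠ 0 := by linarith
  have d1 := (hasDerivAt_id' s).rpow_const (p := 1 - 2*α) (Or.inl (by linarith))
  have d2 := ((hasDerivAt_id' s).const_sub 1).rpow_const (p := 2 - 2*α)
    (Or.inl (by linarith : 1 - s ≠ 0))
  have d3 := ((hasDerivAt_id' s).add_const 1).rpow_const (p := 2 - 2*α)
    (Or.inl (by linarith : s + 1 ≠ 0))
  have d4 := ((hasDerivAt_id' s).const_sub 1).rpow_const (p := 1 - 2*α)
    (Or.inl (by linarith : 1 - s ≠ 0))
  have d5 := ((hasDerivAt_id' s).add_const 1).rpow_const (p := 1 - 2*α)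
    (Or.inl (by linarith : s + 1 ≠ 0))
  have d := ((d1.const_mul (4 * α / (1 - 2*α))).sub ((d2.sub d3).div_const (2 - 2*α))).sub
    ((d4.neg.add d5).div_const (1 - 2*α))
  refine d.congr_deriv ?_
  have e1 : 1 - 2*α - 1 = -(2*α) := by ring
  have e2 : 2 - 2*α - 1 = 1 + -(2*α) := by ring
  rw [e1, e2, Real.rpow_add (by linarith : 0 < 1 - s), Real.rpow_add (by linarith : 0 < s + 1),
    Real.rpow_one, Real.rpow_one, ker_of_lt_one hs, add_comm 1 s]
  field_simp
  ring

lemma continuous_kerPrim {α : ℝ} (hα : α < 1/2) : Continuous (kerPrim α) := by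
  unfold kerPrim
  have h1 : 0 ≤ 1 - 2*α := by linarith
  have h2 : 0 ≤ 2 - 2*α := by linarith
  fun_prop (disch := assumption)

lemma continuous_kerPrimUnit {α : ℝ} (hα : α < 1/2) : Continuous (kerPrimUnit α) := by
  unfold kerPrimUnit
  have h1 : 0 ≤ 1 - 2*α := by linarith
  have h2 : 0 ≤ 2 - 2*α := by linarith
  fun_prop (disch := assumption)

lemma kerPrim_abs_le {α s : ℝ} (hα : α ∈ Ioo (0:ℝ) (1/2)) (hs : 1 < s) :
    |kerPrim α s| ≤ (2 + 2 / (1 - 2*α)) * (2 * (1 - 2*α) * (s - 1) ^ (-(2*α))) := by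
  obtain ⟨h0, h1⟩ := hα
  have hs1 : 0 < s - 1 := by linarith
  have hb0 : 0 < 1 - 2*α := by linarith
  have hb1 : 0 < 2 - 2*α := by linarith
  have hb' : 1 - α*2 ≠ 0 := by linarith
  have hc' : 1 - α ≠ 0 := by linarith
  have hAM : (s - 1) ^ (1 - 2*α) ≤ s ^ (1 - 2*α) :=
    Real.rpow_le_rpow hs1.le (by linarith) hb0.le
  have hMB : s ^ (1 - 2*α) ≤ (s + 1) ^ (1 - 2*α) :=
    Real.rpow_le_rpow (by linarith) (by linarith) hb0.le
  have hBA : (s + 1) ^ (1 - 2*α) ≤ (s - 1) ^ (1 - 2*α) + 2 * (1 - 2*α) * (s - 1) ^ (-(2*α)) := by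
    have hb : (1 + 2 / (s - 1)) ^ (1 - 2*α) ≤ 1 + (1 - 2*α) * (2 / (s - 1)) :=
      rpow_one_add_le_one_add_mul_self
        (le_trans (by norm_num) (by positivity : 0 ≤ 2 / (s - 1))) hb0.le (by linarith)
    have e : s + 1 = (s - 1) * (1 + 2 / (s - 1)) := by field_simp; ring
    have e' : (s - 1) ^ (1 - 2*α) = (s - 1) * (s - 1) ^ (-(2*α)) := by
      rw [sub_eq_add_neg 1 (2*α), Real.rpow_add hs1, Real.rpow_one]
    rw [e, Real.mul_rpow hs1.le (by positivity)]
    refine (mul_le_mul_of_nonneg_left hb (by positivity)).trans_eq ?_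
    rw [e']
    field_simp
  obtain ⟨c, ⟨hc0, hc1⟩, hc⟩ := exists_hasDerivAt_eq_slope
    (fun t : ℝ => t ^ (2 - 2*α) / (2 - 2*α)) (fun t => t ^ (1 - 2*α))
    (by linarith : s - 1 < s + 1)
    (by have := hb1.le; fun_prop (disch := assumption))
    (fun t ht => by
      have d := ((hasDerivAt_id' t).rpow_const (p := 2 - 2*α)
        (Or.inl (by linarith [ht.1]))).div_const (2 - 2*α)
      refine d.congr_deriv ?_
      rw [show 2 - 2*α - 1 = 1 - 2*α by ring]
      field_simp)
  have hcA : (s - 1) ^ (1 - 2*α) ≤ c ^ (1 - 2*α) := Real.rpow_le_rpow hs1.le hc0.le hb0.le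
  have hcB : c ^ (1 - 2*α) ≤ (s + 1) ^ (1 - 2*α) :=
    Real.rpow_le_rpow (by linarith) hc1.le hb0.le
  have hG : kerPrim α s = (2 / (1 - 2*α) - 2) * s ^ (1 - 2*α) + 2 * c ^ (1 - 2*α)
      - ((s - 1) ^ (1 - 2*α) + (s + 1) ^ (1 - 2*α)) / (1 - 2*α) := by
    rw [hc, kerPrim]
    field_simp
    ring
  set A := (s - 1) ^ (1 - 2*α)
  set B := (s + 1) ^ (1 - 2*α)
  set M := s ^ (1 - 2*α)
  set Q := c ^ (1 - 2*α)
  set D := 2 * (1 - 2*α) * (s - 1) ^ (-(2*α))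
  have hr : 0 < 1 / (1 - 2*α) := by positivity
  have : kerPrim α s = 1 / (1 - 2*α) * (2 * M - A - B) + 2 * (Q - M) := by rw [hG]; ring
  rw [this, show (2 + 2 / (1 - 2*α)) * D = 1 / (1 - 2*α) * (2 * D) + 2 * D by ring]
  refine (abs_add_le _ _).trans (add_le_add ?_ ?_)
  · rw [abs_mul, abs_of_pos hr]
    exact mul_le_mul_of_nonneg_left (abs_le.2 ⟨by linarith, by linarith⟩) hr.le
  · rw [abs_mul, abs_two]
    exact mul_le_mul_of_nonneg_left (abs_le.2 ⟨by linarith, by linarith⟩) zero_le_two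

lemma tendsto_kerPrim {α : ℝ} (hα : α ∈ Ioo (0:ℝ) (1/2)) :
    Tendsto (kerPrim α) atTop (nhds 0) := by
  have h := (tendsto_rpow_neg_atTop (by linarith [hα.1] : 0 < 2*α)).comp
    (tendsto_atTop_add_const_right atTop (-1 : ℝ) tendsto_id)
  have h2 := ((h.const_mul (2 * (1 - 2*α))).const_mul (2 + 2 / (1 - 2*α)))
  simp only [mul_zero] at h2
  refine squeeze_zero_norm' ?_ h2
  filter_upwards [eventually_gt_atTop 1] with s hs
  exact kerPrim_abs_le hα hs

lemma intervalIntegrable_ker {α : ℝ} (hα : α ∈ Ioo (0:ℝ) (1/2)) :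
    IntervalIntegrable (ker α) volume 0 1 := by
  have hr : -1 < -(2*α) := by linarith [hα.2]
  have i1 : IntervalIntegrable (fun s : ℝ => s ^ (-(2*α))) volume 0 1 :=
    intervalIntegral.intervalIntegrable_rpow' hr
  have i2 : IntervalIntegrable (fun s : ℝ => (1 - s) ^ (-(2*α))) volume 0 1 := by
    have := (i1.comp_sub_left 1).symm
    simpa using this
  have i3 : IntervalIntegrable (fun s : ℝ => (1 + s) ^ (-(2*α))) volume 0 1 := by
    have := (intervalIntegral.intervalIntegrable_rpow' hr (a := 1) (b := 2)).comp_add_left 1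
    norm_num at this
    exact this
  have i4 := (i1.const_mul (4*α)).sub ((i2.sub i3).continuousOn_mul
    (continuous_id.continuousOn (s := uIcc (0:ℝ) 1)))
  refine i4.congr ?_
  intro s hs
  rw [uIoc_of_le zero_le_one] at hs
  have : |1 - s| = 1 - s := abs_of_nonneg (by linarith [hs.2])
  simp [ker, this]

lemma integrableOn_ker {α : ℝ} (hα : α ∈ Ioo (0:ℝ) (1/2)) : IntegrableOn (ker α) (Ioi 0) := by
  rw [← Ioc_union_Ioi_eq_Ioi zero_le_one]
  refine ((intervalIntegrable_iff_integrableOn_Ioc_of_le zero_le_one).1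
    (intervalIntegrable_ker hα)).union ?_
  exact integrableOn_Ioi_deriv_of_nonpos (continuous_kerPrim hα.2).continuousWithinAt
    (fun s hs => hasDerivAt_kerPrim hα.2 hs) (fun s hs => ker_nonpos hα.1 hs) (tendsto_kerPrim hα)

lemma integral_ker {α : ℝ} (hα : α ∈ Ioo (0:ℝ) (1/2)) : ∫ s in Ioi 0, ker α s = 0 := by
  have hi := integrableOn_ker hα
  rw [← Ioc_union_Ioi_eq_Ioi zero_le_one] at hi ⊢
  rw [setIntegral_union (by
      rw [Set.disjoint_left]; intro s h h'; exact absurd h.2 (not_le.2 h')) measurableSet_Ioi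
      (hi.mono_set subset_union_left) (hi.mono_set subset_union_right),
    ← intervalIntegral.integral_of_le zero_le_one,
    intervalIntegral.integral_eq_sub_of_hasDerivAt_of_le zero_le_one
      (continuous_kerPrimUnit hα.2).continuousOn
      (fun s hs => hasDerivAt_kerPrimUnit hα.2 hs.1 hs.2) (intervalIntegrable_ker hα),
    integral_Ioi_of_hasDerivAt_of_nonpos (continuous_kerPrim hα.2).continuousWithinAt
      (fun s hs => hasDerivAt_kerPrim hα.2 hs) (fun s hs => ker_nonpos hα.1 hs)
      (tendsto_kerPrim hα)]
  have h1 : 1 - 2*α ≠ 0 := by linarith [hα.2]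
  have h2 : 2 - 2*α ≠ 0 := by linarith [hα.2]
  simp [kerPrim, kerPrimUnit, Real.zero_rpow h1, Real.zero_rpow h2]

lemma ae_Ioi_ne_one : ∀ᵐ s ∂(volume.restrict (Ioi (0:ℝ))), 0 < s ∧ s ≠ 1 := by
  filter_upwards [ae_restrict_mem measurableSet_Ioi,
    ae_restrict_of_ae (Measure.ae_ne volume (1:ℝ))] with s h h' using ⟨h, h'⟩

lemma integral_abs_ker_le {α : ℝ} (hα : α ∈ Ioo (0:ℝ) (1/2)) :
    ∫ s in Ioi 0, |ker α s| ≤ 8 * α / (1 - 2*α) := by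
  have hi := integrableOn_ker hα
  have hr : -1 < -(2*α) := by linarith [hα.2]
  have i1 : IntegrableOn (fun s : ℝ => 8 * α * s ^ (-(2*α))) (Ioc 0 1) :=
    (intervalIntegrable_iff_integrableOn_Ioc_of_le zero_le_one).1
      ((intervalIntegral.intervalIntegrable_rpow' hr).const_mul _)
  have e : ∫ s in Ioi 0, |ker α s| = ∫ s in Ioi 0, (|ker α s| + ker α s) := by
    rw [integral_add hi.abs hi, integral_ker hα, add_zero]
  have hsub : Ioi (0:ℝ) ∩ Ioc 0 1 = Ioc 0 1 := inter_eq_right.2 Ioc_subset_Ioi_self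
  have e2 : ∫ s in Ioi (0:ℝ), (Ioc 0 1).indicator (fun s : ℝ => 8 * α * s ^ (-(2*α))) s
      = 8 * α / (1 - 2*α) := by
    rw [setIntegral_indicator measurableSet_Ioc, hsub,
      ← intervalIntegral.integral_of_le zero_le_one, intervalIntegral.integral_const_mul,
      integral_rpow (Or.inl hr), Real.one_rpow, Real.zero_rpow (by linarith)]
    rw [show -(2*α) + 1 = 1 - 2*α by ring]; ring
  rw [e, ← e2]
  refine integral_mono_ae (hi.abs.add hi) ((integrable_indicator_iff measurableSet_Ioc).2 ?_) ?_
  · rw [IntegrableOn, Measure.restrict_restrict measurableSet_Ioc, inter_comm, hsub]; exact i1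
  filter_upwards [ae_Ioi_ne_one] with s hs
  rcases lt_or_gt_of_ne hs.2 with h | h
  · rw [indicator_of_mem (show s ∈ Ioc (0:ℝ) 1 from ⟨hs.1, h.le⟩)]
    have h1 := ker_le hα.1 hs.1 h
    have h2 : 0 ≤ α * s ^ (-(2*α)) := mul_nonneg hα.1.le (Real.rpow_nonneg hs.1.le _)
    rcases abs_cases (ker α s) with h3 | h3 <;> linarith [h3.1]
  · rw [indicator_of_notMem (fun h' => absurd h'.2 (not_le.2 h)),
      abs_of_nonpos (ker_nonpos hα.1 h)]
    linarith

/-- The kernel changes sign once. -/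
lemma exists_ker_sign_change {α : ℝ} (hα : α ∈ Ioo (0:ℝ) (1/2)) :
    ∃ r : ℝ, 0 < r ∧ (∀ s, 0 < s → s < r → s ≠ 1 → 0 ≤ ker α s) ∧
      (∀ s, r < s → s ≠ 1 → ker α s ≤ 0) := by
  set S := {s | s ∈ Ioo (0:ℝ) 1 ∧ 0 ≤ ker α s}
  have hS : α ∈ S := ⟨⟨hα.1, by linarith [hα.2]⟩,
    le_trans (by have := hα.1; positivity) (two_mul_le_ker hα hα.1 le_rfl)⟩
  have hb : BddAbove S := ⟨1, fun s hs => hs.1.2.le⟩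
  have h0 : 0 < sSup S := hα.1.trans_le (le_csSup hb hS)
  refine ⟨sSup S, h0, fun s hs hsr _ => ?_, fun s hs hs1 => ?_⟩
  · obtain ⟨t, ht, hst⟩ := exists_lt_of_lt_csSup ⟨α, hS⟩ hsr
    exact ht.2.trans (ker_antitoneOn hα.1 ⟨hs, hst.trans ht.1.2⟩ ht.1 hst.le)
  · rcases lt_or_gt_of_ne hs1 with h | h
    · by_contra! hc
      exact absurd (le_csSup hb (⟨⟨h0.trans hs, h⟩, hc.le⟩ : s ∈ S)) (not_le.2 hs)
    · exact ker_nonpos hα.1 h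

lemma C0_pos {α : ℝ} (hα : α ∈ Ioo (0:ℝ) (1/2)) : 0 < C0 α := by
  have h1 := Real.Gamma_pos_of_pos (by linarith [hα.1] : 0 < 1 + α)
  have h2 := Real.Gamma_pos_of_pos (by linarith [hα.2] : 0 < 1 - α)
  unfold C0
  positivity

lemma C3_pos {α : ℝ} (hα : α ∈ Ioo (0:ℝ) (1/2)) : 0 < C3 α := by
  obtain ⟨h0, h1⟩ := hα
  have g1 := Real.Gamma_pos_of_pos h0
  have g2 := Real.Gamma_pos_of_pos (by linarith : 0 < 2 - α)
  have e : (4:ℝ) ≤ 4 ^ (1 + α) := by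
    simpa using Real.rpow_le_rpow_of_exponent_le (by norm_num : (1:ℝ) ≤ 4)
      (by linarith : 1 ≤ 1 + α)
  have p : 0 < α - 4 * α ^ 3 := by
    have : 0 < α * ((1 - 2*α) * (1 + 2*α)) :=
      mul_pos h0 (mul_pos (by linarith) (by linarith))
    nlinarith
  have q1 : 0 < 5 - 2*α := by linarith
  have q2 : 0 < 3 - 2*α := by linarith
  have q3 : 0 < 1 - 2*α := by linarith
  have q4 : 0 < (4:ℝ) ^ (1 + α) - 4 + α - 4 * α ^ 3 := by linarith
  unfold C3
  positivity

lemma deltaU_pos {α t0 : ℝ} (hα : α ∈ Ioo (0:ℝ) (1/2)) (ht0 : 1 < t0) : 0 < deltaU α t0 := by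
  have h := C3_pos hα
  have : 0 < t0 := by linarith
  unfold deltaU
  positivity

lemma W1.mem_Icc {α t0 δl : ℝ} {f : ℝ → ℝ} (hf : W1 α t0 δl f) (y : ℝ) : f y ∈ Icc (0:ℝ) 1 := by
  obtain ⟨-, -, heven, h0, hnn, hanti, -⟩ := hf
  have key : ∀ z : ℝ, 0 ≤ z → f z ∈ Icc (0:ℝ) 1 := fun z hz =>
    ⟨hnn z hz, h0 ▸ hanti (mem_Ici.2 le_rfl) (mem_Ici.2 hz) hz⟩
  rcases le_total 0 y with h | h
  · exact key y h
  · rw [← heven y]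
    exact key (-y) (by linarith)

lemma W1.one_pos {α t0 δl : ℝ} {f : ℝ → ℝ} (hf : W1 α t0 δl f) : 0 < f 1 := by
  obtain ⟨-, -, -, -, -, -, -, hl, -⟩ := hf
  refine lt_of_lt_of_le ?_ (hl 1)
  unfold fl
  positivity

lemma W1.tendsto_zero {α t0 δl : ℝ} {f : ℝ → ℝ} (hα : α ∈ Ioo (0:ℝ) (1/2)) (ht0 : 1 < t0)
    (hf : W1 α t0 δl f) : Tendsto f atTop (nhds 0) := by
  have h := (tendsto_rpow_neg_atTop (deltaU_pos hα ht0)).const_mul (t0 ^ deltaU α t0)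
  rw [mul_zero] at h
  refine squeeze_zero' (Eventually.of_forall fun y => (hf.mem_Icc y).1) ?_ h
  filter_upwards [eventually_gt_atTop 0] with y hy
  obtain ⟨-, -, -, -, -, -, -, -, hu, -⟩ := hf
  refine (hu y).trans ?_
  rw [fu, if_neg hy.ne', abs_of_pos hy]
  exact min_le_right _ _

lemma Tfr_eq {α : ℝ} (hα : α < 1/2) (f : ℝ → ℝ) (x : ℝ) :
    Tfr α f x = C0 α / α * (|x| ^ (1 - 2*α) * ∫ s in Ioi (0:ℝ), f (|x| * s) * ker α s) := by
  rcases eq_or_ne x 0 with rfl | hx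
  · rw [Tfr, if_pos rfl, abs_zero, Real.zero_rpow (by linarith)]
    ring
  rw [Tfr, if_neg hx]
  have hy : 0 < |x| := abs_pos.2 hx
  set y := |x|
  have h := integral_comp_mul_left_Ioi (fun ξ => f ξ * (4*α * ξ ^ (-(2*α))
    - (ξ / y) * (|y - ξ| ^ (-(2*α)) - (y + ξ) ^ (-(2*α))))) 0 hy
  rw [mul_zero, smul_eq_mul, eq_inv_mul_iff_mul_eq₀ hy.ne'] at h
  rw [← h]
  congr 1
  rw [sub_eq_add_neg 1 (2*α), Real.rpow_add hy, Real.rpow_one, mul_assoc,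
    ← integral_const_mul (y ^ (-(2*α)))]
  congr 1
  refine setIntegral_congr_fun measurableSet_Ioi fun s hs => ?_
  have hs : 0 < s := hs
  have e1 : |y - y * s| = y * |1 - s| := by
    rw [← mul_one_sub, abs_mul, abs_of_pos hy]
  have e2 : y + y * s = y * (1 + s) := by ring
  rw [e1, e2, Real.mul_rpow hy.le hs.le, Real.mul_rpow hy.le (abs_nonneg _),
    Real.mul_rpow hy.le (by linarith), ker, mul_div_cancel_left₀ _ hy.ne']
  ring

lemma integrableOn_mul_ker {α : ℝ} (hα : α ∈ Ioo (0:ℝ) (1/2)) {f : ℝ → ℝ} {N : ℝ}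
    (hm : Measurable f) (hN : ∀ y, |f y| ≤ N) (y : ℝ) :
    IntegrableOn (fun s => f (y * s) * ker α s) (Ioi 0) :=
  (integrableOn_ker hα).bdd_mul (c := N)
    (hm.comp (measurable_const_mul y)).aestronglyMeasurable
    (Eventually.of_forall fun s => hN (y * s))

lemma measurable_Tfr {α : ℝ} (hα : α < 1/2) {f : ℝ → ℝ} (hm : Measurable f) :
    Measurable (Tfr α f) := by
  have h : StronglyMeasurable
      (fun p : ℝ × ℝ => f (|p.1| * p.2) * ker α p.2) := by
    refine Measurable.stronglyMeasurable ?_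
    exact (hm.comp (by fun_prop)).mul ((measurable_ker α).comp measurable_snd)
  have h2 := (h.integral_prod_right' (ν := volume.restrict (Ioi (0:ℝ)))).measurable
  rw [show Tfr α f = _ from funext (Tfr_eq hα f)]
  exact ((measurable_abs.pow_const _).mul h2).const_mul _

lemma abs_Tfr_le {α : ℝ} (hα : α ∈ Ioo (0:ℝ) (1/2)) {f : ℝ → ℝ} {N : ℝ}
    (hN : ∀ y, |f y| ≤ N) (x : ℝ) :
    |Tfr α f x| ≤ 8 * C0 α / (1 - 2*α) * N * |x| ^ (1 - 2*α) := by
  have h0 := hα.1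
  have hc := C0_pos hα
  have hN0 : 0 ≤ N := (abs_nonneg _).trans (hN 0)
  have hI : |∫ s in Ioi (0:ℝ), f (|x| * s) * ker α s| ≤ N * (8 * α / (1 - 2*α)) := by
    calc |∫ s in Ioi (0:ℝ), f (|x| * s) * ker α s|
        ≤ ∫ s in Ioi (0:ℝ), N * |ker α s| := by
          rw [← Real.norm_eq_abs]
          refine norm_integral_le_of_norm_le ((integrableOn_ker hα).abs.const_mul N)
            (Eventually.of_forall fun s => ?_)
          rw [Real.norm_eq_abs, abs_mul]
          exact mul_le_mul_of_nonneg_right (hN _) (abs_nonneg _)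
      _ ≤ N * (8 * α / (1 - 2*α)) := by
          rw [integral_const_mul]
          exact mul_le_mul_of_nonneg_left (integral_abs_ker_le hα) hN0
  rw [Tfr_eq hα.2, abs_mul, abs_mul, abs_of_pos (div_pos hc h0),
    abs_of_nonneg (Real.rpow_nonneg (abs_nonneg x) _)]
  calc C0 α / α * (|x| ^ (1 - 2*α) * |∫ s in Ioi (0:ℝ), f (|x| * s) * ker α s|)
      ≤ C0 α / α * (|x| ^ (1 - 2*α) * (N * (8 * α / (1 - 2*α)))) := by gcongr
    _ = _ := by
      have : 1 - α*2 ≠ 0 := by linarith [hα.2]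
      field_simp

lemma Tfr_sub {α : ℝ} (hα : α ∈ Ioo (0:ℝ) (1/2)) {f g : ℝ → ℝ} {M N : ℝ}
    (hfm : Measurable f) (hf : ∀ y, |f y| ≤ M) (hgm : Measurable g) (hg : ∀ y, |g y| ≤ N)
    (x : ℝ) : Tfr α f x - Tfr α g x = Tfr α (fun y => f y - g y) x := by
  simp only [Tfr_eq hα.2, sub_mul]
  rw [integral_sub (integrableOn_mul_ker hα hfm hf _) (integrableOn_mul_ker hα hgm hg _)]
  ring

lemma integral_mul_ker_eq {α : ℝ} (hα : α ∈ Ioo (0:ℝ) (1/2)) {f : ℝ → ℝ} {N : ℝ}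
    (hm : Measurable f) (hN : ∀ y, |f y| ≤ N) (y c : ℝ) :
    ∫ s in Ioi (0:ℝ), f (y * s) * ker α s = ∫ s in Ioi (0:ℝ), (f (y * s) - c) * ker α s := by
  simp only [sub_mul]
  rw [integral_sub (integrableOn_mul_ker hα hm hN _) ((integrableOn_ker hα).const_mul c),
    integral_const_mul, integral_ker hα, mul_zero, sub_zero]

lemma integrableOn_sub_mul_ker {α : ℝ} (hα : α ∈ Ioo (0:ℝ) (1/2)) {f : ℝ → ℝ} {N : ℝ}
    (hm : Measurable f) (hN : ∀ y, |f y| ≤ N) (y c : ℝ) :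
    IntegrableOn (fun s => (f (y * s) - c) * ker α s) (Ioi 0) := by
  simp only [sub_mul]
  exact (integrableOn_mul_ker hα hm hN y).sub ((integrableOn_ker hα).const_mul c)

lemma sub_mul_ker_nonneg {α : ℝ} (hα : α ∈ Ioo (0:ℝ) (1/2)) :
    ∃ r : ℝ, 0 < r ∧ ∀ f : ℝ → ℝ, AntitoneOn f (Ici 0) → ∀ y : ℝ, 0 ≤ y →
      ∀ᵐ s ∂(volume.restrict (Ioi (0:ℝ))), 0 ≤ (f (y * s) - f (y * r)) * ker α s := by
  obtain ⟨r, hr, hpos, hneg⟩ := exists_ker_sign_change hα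
  refine ⟨r, hr, fun f hf y hy => ?_⟩
  filter_upwards [ae_Ioi_ne_one] with s hs
  have hys : y * s ∈ Ici (0:ℝ) := mul_nonneg hy hs.1.le
  have hyr : y * r ∈ Ici (0:ℝ) := mul_nonneg hy hr.le
  rcases lt_trichotomy s r with h | rfl | h
  · exact mul_nonneg (sub_nonneg.2 (hf hys hyr (by gcongr))) (hpos s hs.1 h hs.2)
  · simp
  · exact mul_nonneg_of_nonpos_of_nonpos (sub_nonpos.2 (hf hyr hys (by gcongr)))
      (hneg s h hs.2)

lemma Tfr_nonneg {α : ℝ} (hα : α ∈ Ioo (0:ℝ) (1/2)) {f : ℝ → ℝ} {N : ℝ}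
    (hm : Measurable f) (hN : ∀ y, |f y| ≤ N) (hanti : AntitoneOn f (Ici 0)) (x : ℝ) :
    0 ≤ Tfr α f x := by
  obtain ⟨r, -, h⟩ := sub_mul_ker_nonneg hα
  rw [Tfr_eq hα.2, integral_mul_ker_eq hα hm hN |x| (f (|x| * r))]
  have h1 := (div_pos (C0_pos hα) hα.1).le
  have h2 := integral_nonneg_of_ae (h f hanti |x| (abs_nonneg x))
  positivity

lemma eventually_le_Tfr {α : ℝ} (hα : α ∈ Ioo (0:ℝ) (1/2)) {f : ℝ → ℝ} {N : ℝ}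
    (hm : Measurable f) (hN : ∀ y, |f y| ≤ N) (hanti : AntitoneOn f (Ici 0)) (h1 : 0 < f 1)
    (hlim : Tendsto f atTop (nhds 0)) : ∀ᶠ x in atTop, C0 α * f 1 ≤ Tfr α f x := by
  obtain ⟨r, hr, h⟩ := sub_mul_ker_nonneg hα
  have ha := hα.1
  have hsmall : ∀ᶠ x in atTop, f (x * r) < f 1 / 2 :=
    (hlim.comp (tendsto_id.atTop_mul_const hr)).eventually_lt_const (by linarith)
  filter_upwards [hsmall, eventually_ge_atTop (1/α), eventually_gt_atTop 0] with y hy hyα hy0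
  have hyi : 1 / y ≤ α := by
    rw [div_le_iff₀ hy0]; rwa [div_le_iff₀' ha] at hyα
  have hi := integrableOn_sub_mul_ker hα hm hN y (f (y * r))
  have hsub : Ioc 0 (1/y) ⊆ Ioi (0:ℝ) := Ioc_subset_Ioi_self
  have hI : α * f 1 * (y ^ (2*α) * y⁻¹)
      ≤ ∫ s in Ioi (0:ℝ), (f (y * s) - f (y * r)) * ker α s := by
    calc α * f 1 * (y ^ (2*α) * y⁻¹) = ∫ s in Ioc 0 (1/y), f 1 / 2 * (2 * α * y ^ (2*α)) := by
          rw [setIntegral_const, measureReal_def, Real.volume_Ioc, sub_zero,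
            ENNReal.toReal_ofReal (by positivity), smul_eq_mul]
          ring
      _ ≤ ∫ s in Ioc 0 (1/y), (f (y * s) - f (y * r)) * ker α s := by
          refine setIntegral_mono_on (integrableOn_const measure_Ioc_lt_top.ne) (hi.mono_set hsub)
            measurableSet_Ioc fun s hs => ?_
          have hys : y * s ≤ 1 := by
            have := hs.2
            rwa [le_div_iff₀' hy0] at this
          have hf1 := hanti (show y * s ∈ Ici (0:ℝ) from mul_nonneg hy0.le hs.1.le)
            (mem_Ici.2 zero_le_one) hys
          have hk := two_mul_le_ker hα hs.1 (hs.2.trans hyi)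
          have hp : y ^ (2*α) ≤ s ^ (-(2*α)) := by
            rw [Real.rpow_neg hs.1.le, ← Real.inv_rpow hs.1.le]
            refine Real.rpow_le_rpow hy0.le ?_ (by linarith)
            rw [le_inv_comm₀ hy0 hs.1, ← one_div]
            exact hs.2
          have hk' : 2 * α * y ^ (2*α) ≤ ker α s :=
            (mul_le_mul_of_nonneg_left hp (by linarith)).trans hk
          exact mul_le_mul (by linarith) hk' (by positivity) (by linarith)
      _ ≤ _ := setIntegral_mono_set hi (h f hanti y hy0.le) hsub.eventuallyLE
  rw [Tfr_eq hα.2, abs_of_pos hy0, integral_mul_ker_eq hα hm hN y (f (y * r))]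
  have hc := C0_pos hα
  have hpow : y ^ (1 - 2*α) * (y ^ (2*α) * y⁻¹) = 1 := by
    rw [← mul_assoc, ← Real.rpow_add hy0, sub_add_cancel, Real.rpow_one, mul_inv_cancel₀ hy0.ne']
  calc C0 α * f 1 = C0 α / α * (α * f 1 * (y ^ (1 - 2*α) * (y ^ (2*α) * y⁻¹))) := by
        rw [hpow]; field_simp
    _ = C0 α / α * (y ^ (1 - 2*α) * (α * f 1 * (y ^ (2*α) * y⁻¹))) := by ring
    _ ≤ _ := by gcongr

/-- The integrand in the exponent of `ℜ_α`. -/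
def rate (α : ℝ) (f : ℝ → ℝ) (y : ℝ) : ℝ := Tfr α f y / (y * (1 + Tfr α f y))

lemma abs_exp_neg_sub_exp_neg_le {a b : ℝ} (ha : 0 ≤ a) (hb : 0 ≤ b) :
    |Real.exp (-a) - Real.exp (-b)| ≤ |a - b| := by
  have key : ∀ a b : ℝ, 0 ≤ a → a ≤ b → Real.exp (-a) - Real.exp (-b) ≤ b - a := by
    intro a b ha hab
    have h1 : Real.exp (-a) ≤ 1 := Real.exp_le_one_iff.2 (by linarith)
    have h2 := Real.add_one_le_exp (a - b)
    have h3 : Real.exp (-b) = Real.exp (-a) * Real.exp (a - b) := by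
      rw [← Real.exp_add]; ring_nf
    have h4 := Real.exp_pos (-a)
    rw [h3]
    nlinarith
  rcases le_total a b with h | h
  · rw [abs_of_nonneg (sub_nonneg.2 (Real.exp_le_exp.2 (by linarith))), abs_sub_comm,
      abs_of_nonneg (sub_nonneg.2 h)]
    exact key a b ha h
  · rw [abs_sub_comm, abs_of_nonneg (sub_nonneg.2 (Real.exp_le_exp.2 (by linarith))),
      abs_of_nonneg (sub_nonneg.2 h)]
    exact key b a hb h

lemma W1.measurable {α t0 δl : ℝ} {f : ℝ → ℝ} (hf : W1 α t0 δl f) : Measurable f :=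
  hf.1.measurable

lemma W1.abs_le_one {α t0 δl : ℝ} {f : ℝ → ℝ} (hf : W1 α t0 δl f) (y : ℝ) : |f y| ≤ 1 := by
  rw [abs_of_nonneg (hf.mem_Icc y).1]
  exact (hf.mem_Icc y).2

lemma W1.antitoneOn {α t0 δl : ℝ} {f : ℝ → ℝ} (hf : W1 α t0 δl f) : AntitoneOn f (Ici 0) :=
  hf.2.2.2.2.2.1

lemma W1.Tfr_nonneg {α t0 δl : ℝ} {f : ℝ → ℝ} (hα : α ∈ Ioo (0:ℝ) (1/2)) (hf : W1 α t0 δl f)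
    (x : ℝ) : 0 ≤ Tfr α f x :=
  GSQGhalfplane.Tfr_nonneg hα hf.measurable hf.abs_le_one hf.antitoneOn x

lemma W1.rate_nonneg {α t0 δl : ℝ} {f : ℝ → ℝ} (hα : α ∈ Ioo (0:ℝ) (1/2)) (hf : W1 α t0 δl f)
    {y : ℝ} (hy : 0 ≤ y) : 0 ≤ rate α f y := by
  have := hf.Tfr_nonneg hα y
  unfold rate
  positivity

lemma rpow_one_sub_div {y : ℝ} (hy : 0 < y) (α : ℝ) : y ^ (1 - 2*α) / y = y ^ (-(2*α)) := by
  rw [← Real.rpow_sub_one hy.ne']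
  ring_nf

lemma intervalIntegrable_const_mul_rpow {α : ℝ} (hα : α < 1/2) (c a b : ℝ) :
    IntervalIntegrable (fun y : ℝ => c * y ^ (-(2*α))) volume a b :=
  (intervalIntegral.intervalIntegrable_rpow' (by linarith)).const_mul _

lemma W1.rate_le {α t0 δl : ℝ} {f : ℝ → ℝ} (hα : α ∈ Ioo (0:ℝ) (1/2)) (hf : W1 α t0 δl f)
    {y : ℝ} (hy : 0 < y) : rate α f y ≤ 8 * C0 α / (1 - 2*α) * y ^ (-(2*α)) := by
  have h0 := hf.Tfr_nonneg hα y
  have h1 := abs_Tfr_le hα hf.abs_le_one y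
  rw [abs_of_nonneg h0, abs_of_pos hy, mul_one] at h1
  calc rate α f y ≤ Tfr α f y / y :=
        div_le_div_of_nonneg_left h0 hy (by nlinarith)
    _ ≤ (8 * C0 α / (1 - 2*α) * y ^ (1 - 2*α)) / y := by gcongr
    _ = _ := by rw [mul_div_assoc, rpow_one_sub_div hy]

lemma W1.intervalIntegrable_rate {α t0 δl : ℝ} {f : ℝ → ℝ} (hα : α ∈ Ioo (0:ℝ) (1/2))
    (hf : W1 α t0 δl f) {a b : ℝ} (ha : 0 ≤ a) (hab : a ≤ b) :
    IntervalIntegrable (rate α f) volume a b := by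
  have hT := measurable_Tfr hα.2 hf.measurable
  refine (intervalIntegrable_const_mul_rpow hα.2 (8 * C0 α / (1 - 2*α)) a b).mono_fun'
    (hT.div (measurable_id.mul (measurable_const.add hT))).aestronglyMeasurable ?_
  filter_upwards [ae_restrict_mem measurableSet_uIoc] with y hy
  rw [uIoc_of_le hab] at hy
  have hy0 : 0 < y := ha.trans_lt hy.1
  rw [Real.norm_eq_abs, abs_of_nonneg (hf.rate_nonneg hα hy0.le)]
  exact hf.rate_le hα hy0

lemma W1.abs_rate_sub_le {α t0 δl : ℝ} {f g : ℝ → ℝ} {N : ℝ} (hα : α ∈ Ioo (0:ℝ) (1/2))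
    (hf : W1 α t0 δl f) (hg : W1 α t0 δl g) (hN : ∀ y, |f y - g y| ≤ N) {y : ℝ} (hy : 0 < y) :
    |rate α f y - rate α g y| ≤ 8 * C0 α / (1 - 2*α) * N * y ^ (-(2*α)) := by
  have hf0 := hf.Tfr_nonneg hα y
  have hg0 := hg.Tfr_nonneg hα y
  have h1 := abs_Tfr_le hα hN y
  rw [← Tfr_sub hα hf.measurable hf.abs_le_one hg.measurable hg.abs_le_one, abs_of_pos hy] at h1
  set S := Tfr α f y
  set T := Tfr α g y
  have e : rate α f y - rate α g y = (S - T) / (y * ((1 + S) * (1 + T))) := by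
    change S / (y * (1 + S)) - T / (y * (1 + T)) = _
    have : 1 + S ≠ 0 := by positivity
    have : 1 + T ≠ 0 := by positivity
    field_simp
    ring
  rw [e, abs_div, abs_of_pos (by positivity : 0 < y * ((1 + S) * (1 + T)))]
  calc |S - T| / (y * ((1 + S) * (1 + T))) ≤ |S - T| / y :=
        div_le_div_of_nonneg_left (abs_nonneg _) hy
          (le_mul_of_one_le_right hy.le (one_le_mul_of_one_le_of_one_le (by linarith) (by linarith)))
    _ ≤ (8 * C0 α / (1 - 2*α) * N * y ^ (1 - 2*α)) / y := by gcongr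
    _ = _ := by rw [mul_div_assoc, rpow_one_sub_div hy]

lemma W1.integral_rate_nonneg {α t0 δl : ℝ} {f : ℝ → ℝ} (hα : α ∈ Ioo (0:ℝ) (1/2))
    (hf : W1 α t0 δl f) {a b : ℝ} (ha : 0 ≤ a) (hab : a ≤ b) :
    0 ≤ ∫ y in a..b, rate α f y :=
  intervalIntegral.integral_nonneg hab fun _ hy => hf.rate_nonneg hα (ha.trans hy.1)

lemma Rfr_eq (α : ℝ) (f : ℝ → ℝ) (x : ℝ) :
    Rfr α f x = Real.exp (-(∫ y in (0:ℝ)..|x|, rate α f y)) := rfl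

lemma W1.abs_Rfr_sub_le {α t0 δl : ℝ} {f g : ℝ → ℝ} {N : ℝ} (hα : α ∈ Ioo (0:ℝ) (1/2))
    (hf : W1 α t0 δl f) (hg : W1 α t0 δl g) (hN : ∀ y, |f y - g y| ≤ N) (x : ℝ) :
    |Rfr α f x - Rfr α g x| ≤ 10 * C0 α / (1 - 2*α)^2 * N * |x| ^ (1 - 2*α) := by
  have hx := abs_nonneg x
  have hc := C0_pos hα
  have hb : 0 < 1 - 2*α := by linarith [hα.2]
  have hN0 : 0 ≤ N := (abs_nonneg _).trans (hN 0)
  rw [Rfr_eq, Rfr_eq]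
  refine (abs_exp_neg_sub_exp_neg_le (hf.integral_rate_nonneg hα le_rfl hx)
    (hg.integral_rate_nonneg hα le_rfl hx)).trans ?_
  rw [← intervalIntegral.integral_sub (hf.intervalIntegrable_rate hα le_rfl hx)
    (hg.intervalIntegrable_rate hα le_rfl hx)]
  have h := intervalIntegral.norm_integral_le_of_norm_le (μ := volume)
    (f := fun y => rate α f y - rate α g y) hx
    (Eventually.of_forall fun y hy => hf.abs_rate_sub_le hα hg hN hy.1)
    (intervalIntegrable_const_mul_rpow hα.2 _ 0 |x|)
  refine h.trans ?_
  rw [intervalIntegral.integral_const_mul, integral_rpow (Or.inl (by linarith)),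
    show -(2*α) + 1 = 1 - 2*α by ring, Real.zero_rpow hb.ne', sub_zero]
  calc 8 * C0 α / (1 - 2*α) * N * (|x| ^ (1 - 2*α) / (1 - 2*α))
      = 8 * (C0 α / (1 - 2*α)^2 * N * |x| ^ (1 - 2*α)) := by
        field_simp
    _ ≤ 10 * (C0 α / (1 - 2*α)^2 * N * |x| ^ (1 - 2*α)) := by gcongr; norm_num
    _ = _ := by ring

lemma W1.Rfr_le_Rfr {α t0 δl : ℝ} {f : ℝ → ℝ} (hα : α ∈ Ioo (0:ℝ) (1/2)) (hf : W1 α t0 δl f)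
    {x y : ℝ} (hxy : |x| ≤ |y|) : Rfr α f y ≤ Rfr α f x := by
  rw [Rfr_eq, Rfr_eq, Real.exp_le_exp, neg_le_neg_iff,
    ← intervalIntegral.integral_add_adjacent_intervals
      (hf.intervalIntegrable_rate hα le_rfl (abs_nonneg x))
      (hf.intervalIntegrable_rate hα (abs_nonneg x) hxy)]
  linarith [hf.integral_rate_nonneg hα (abs_nonneg x) hxy]

lemma W1.tendsto_Rfr {α t0 δl : ℝ} {f : ℝ → ℝ} (hα : α ∈ Ioo (0:ℝ) (1/2)) (ht0 : 1 < t0)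
    (hf : W1 α t0 δl f) : Tendsto (Rfr α f) atTop (nhds 0) := by
  set m := C0 α * f 1
  have hm : 0 < m := mul_pos (C0_pos hα) hf.one_pos
  obtain ⟨X, hX0, hX⟩ := ((eventually_le_Tfr hα hf.measurable hf.abs_le_one hf.antitoneOn
    hf.one_pos (hf.tendsto_zero hα ht0)).and (eventually_gt_atTop 0)).exists_forall_of_atTop
    |>.imp fun X h => (⟨(h X le_rfl).2, fun y hy => (h y hy).1⟩ :
      0 < X ∧ ∀ y, X ≤ y → m ≤ Tfr α f y)
  have hlog : Tendsto (fun x => m / (1 + m) * (Real.log x - Real.log X)) atTop atTop :=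
    (tendsto_atTop_add_const_right atTop _ Real.tendsto_log_atTop).const_mul_atTop
      (by positivity)
  have hle : ∀ᶠ x in atTop,
      m / (1 + m) * (Real.log x - Real.log X) ≤ ∫ y in (0:ℝ)..|x|, rate α f y := by
    filter_upwards [eventually_ge_atTop X] with x hx
    rw [abs_of_pos (hX0.trans_le hx), ← intervalIntegral.integral_add_adjacent_intervals
      (hf.intervalIntegrable_rate hα le_rfl hX0.le) (hf.intervalIntegrable_rate hα hX0.le hx)]
    have hint : IntervalIntegrable (fun y : ℝ => m / (1 + m) * y⁻¹) volume X x :=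
      (intervalIntegrable_inv_iff.2 (Or.inr (by
        rw [uIcc_of_le hx]; exact fun h => absurd h.1 (not_le.2 hX0)))).const_mul _
    have hmono : ∫ y in X..x, m / (1 + m) * y⁻¹ ≤ ∫ y in X..x, rate α f y := by
      refine intervalIntegral.integral_mono_on hx hint
        (hf.intervalIntegrable_rate hα hX0.le hx) fun y hy => ?_
      have hy0 : 0 < y := hX0.trans_le hy.1
      have hT := hX y hy.1
      have hT0 : 0 < 1 + Tfr α f y := by linarith
      rw [rate, mul_comm y, ← div_div, div_eq_mul_inv _ y]
      refine mul_le_mul_of_nonneg_right ?_ (inv_pos.2 hy0).le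
      rw [div_le_div_iff₀ (by positivity) hT0]
      nlinarith
    rw [intervalIntegral.integral_const_mul, integral_inv_of_pos hX0 (hX0.trans_le hx),
      Real.log_div (hX0.trans_le hx).ne' hX0.ne'] at hmono
    linarith [hf.integral_rate_nonneg hα le_rfl hX0.le]
  exact Real.tendsto_exp_neg_atTop_nhds_zero.comp (tendsto_atTop_mono' _ hle hlog)

lemma W1.abs_sub_le_iSup {α t0 δl : ℝ} {f g : ℝ → ℝ} (hf : W1 α t0 δl f) (hg : W1 α t0 δl g)
    (y : ℝ) : |f y - g y| ≤ ⨆ z : ℝ, |f z - g z| := by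
  refine le_ciSup (f := fun z : ℝ => |f z - g z|) ⟨1, ?_⟩ y
  rintro _ ⟨z, rfl⟩
  have h1 := hf.mem_Icc z
  have h2 := hg.mem_Icc z
  exact abs_le.2 ⟨by linarith [h1.1, h2.2], by linarith [h1.2, h2.1]⟩

lemma W1.continuousAt_Rfr {α t0 δl : ℝ} {g : ℝ → ℝ} (hα : α ∈ Ioo (0:ℝ) (1/2)) (ht0 : 1 < t0)
    (hg : W1 α t0 δl g) {ε : ℝ} (hε : 0 < ε) :
    ∃ δ : ℝ, 0 < δ ∧ ∀ f : ℝ → ℝ, W1 α t0 δl f → (⨆ y : ℝ, |f y - g y|) ≤ δ →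
      (⨆ y : ℝ, |Rfr α f y - Rfr α g y|) ≤ ε := by
  obtain ⟨X, hXε, hX0⟩ := (((hg.tendsto_Rfr hα ht0).eventually_lt_const (half_pos hε)).and
    (eventually_gt_atTop 0)).exists
  have hc := C0_pos hα
  have hb : 0 < 1 - 2*α := by linarith [hα.2]
  set K := 10 * C0 α / (1 - 2*α)^2
  have hK0 : 0 < K := by positivity
  have hK : 0 < K * X ^ (1 - 2*α) := by positivity
  refine ⟨ε / 2 / (K * X ^ (1 - 2*α)), by positivity, fun f hf hfg => ?_⟩
  have hclose : ∀ y, |y| ≤ X → |Rfr α f y - Rfr α g y| ≤ ε / 2 := by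
    intro y hy
    refine (hf.abs_Rfr_sub_le hα hg (fun z => (hf.abs_sub_le_iSup hg z).trans hfg) y).trans ?_
    calc K * (ε / 2 / (K * X ^ (1 - 2*α))) * |y| ^ (1 - 2*α)
        ≤ K * (ε / 2 / (K * X ^ (1 - 2*α))) * X ^ (1 - 2*α) := by gcongr
      _ = ε / 2 := by field_simp
  refine ciSup_le fun y => ?_
  rcases le_total |y| X with hy | hy
  · linarith [hclose y hy]
  · have hX := (abs_le.1 (hclose X (abs_of_pos hX0).le)).2
    have hy' : |X| ≤ |y| := by rwa [abs_of_pos hX0]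
    have h1 := hf.Rfr_le_Rfr hα hy'
    have h2 := hg.Rfr_le_Rfr hα hy'
    have h3 : 0 < Rfr α f y := Real.exp_pos _
    have h4 : 0 < Rfr α g y := Real.exp_pos _
    exact abs_le.2 ⟨by linarith, by linarith⟩

/-- Quantitative continuity of `ℜ_α` on `𝒲₁`:
`|ℜ_α(f)(x) - ℜ_α(f₀)(x)| ≤ (10 c_{0,α}/(1-2α)²) ‖f - f₀‖_{L^∞} |x|^{1-2α}`,
and consequently `ℜ_α : 𝒲₁ → 𝒲₁` is continuous in the sup-norm. -/
theorem Rfr_continuous (α t0 δl : ℝ) (hα : α ∈ Ioo (0:ℝ) (1/2)) (ht0 : 1 < t0)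
    (ht1 : max (1 / C3 α) ((1 - 2*α) / (2*α * C3 α)) < t0 ^ (1/2 - α))
    (ht2 : (2:ℝ) ^ ((2:ℝ) ^ α + 2) * Real.Gamma (2 + α) * Real.Gamma (1/2 - α) /
        (3*π*α*Real.Gamma (1 - α)) < t0 ^ (1/2 + α))
    (hδl : 1/2 ≤ δl)
    (hδ1 : (2:ℝ) ^ (2*α) * Real.Gamma (2 + α) * Real.Gamma (1/2 - α) /
        (3*π*Real.Gamma (1 - α)) ≤
        Real.Gamma (δl + 1) * t0 ^ (2*α - 1) / Real.Gamma (δl + α + 1/2))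
    (hδ2 : Real.Gamma (δl + 1) * t0 ^ (2*α - 1) / Real.Gamma (δl + α + 1/2) ≤
        (2:ℝ) ^ (2*α + 1) * Real.Gamma (2 + α) * Real.Gamma (1/2 - α) /
        (3*π*Real.Gamma (1 - α))) :
    (∀ f f₀ : ℝ → ℝ, W1 α t0 δl f → W1 α t0 δl f₀ → ∀ x : ℝ,
      |Rfr α f x - Rfr α f₀ x| ≤
        10 * C0 α / (1 - 2*α)^2 * (⨆ y : ℝ, |f y - f₀ y|) * |x| ^ (1 - 2*α)) ∧
    (∀ f₀ : ℝ → ℝ, W1 α t0 δl f₀ → ∀ ε : ℝ, 0 < ε →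
      ∃ δ : ℝ, 0 < δ ∧ ∀ f : ℝ → ℝ, W1 α t0 δl f →
        (⨆ y : ℝ, |f y - f₀ y|) ≤ δ →
        (⨆ y : ℝ, |Rfr α f y - Rfr α f₀ y|) ≤ ε) := by
  exact ⟨fun f f₀ hf hf₀ x => hf.abs_Rfr_sub_le hα hf₀ (hf.abs_sub_le_iSup hf₀) x,
    fun f₀ hf₀ ε hε => hf₀.continuousAt_Rfr hα ht0 hε⟩

end GSQGhalfplane
end
end

section
/- For every α ∈ (0,1/2), if f ∈ 𝒲₁ satisfies ℜ_α(f) = f, then 𝔟(f) > 1/(2α) − 1; equivalently, the scaling parameter c_ℓ := 1 + 𝔟(f) satisfies 2α c_ℓ − 1 > 0, so the fixed point corresponds to a focusing-type self-similar blow-up. -/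
open Real MeasureTheory Set Filter BoundedContinuousFunction

noncomputable section

namespace GSQGhalfplane

lemma deltaU_mem_Ioo {α t0 : ℝ} (hα : α ∈ Ioo (0:ℝ) (1/2)) (ht0 : 1 < t0)
    (h : (1 - 2*α) / (2*α * C3 α) < t0 ^ (1/2 - α)) :
    deltaU α t0 ∈ Ioo (1 - 2*α) 1 := by
  have hC := C3_pos hα
  obtain ⟨h0, h1⟩ := hα
  have hs : 0 < C3 α * t0 ^ (1/2 - α) := by positivity
  rw [div_lt_iff₀ (by positivity)] at h
  unfold deltaU
  constructor
  · rw [lt_div_iff₀ (by positivity)]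
    nlinarith
  · rw [div_lt_one (by positivity)]
    linarith

/-- The difference kernel `|1-η|^{-p} - (1+η)^{-p}`. -/
def diffKernel (p η : ℝ) : ℝ := |1 - η| ^ (-p) - (1 + η) ^ (-p)

lemma measurable_diffKernel (p : ℝ) : Measurable (diffKernel p) := by
  unfold diffKernel
  fun_prop

lemma diffKernel_nonneg {p η : ℝ} (hp : 0 < p) (hη : 0 < η) (h1 : η ≠ 1) :
    0 ≤ diffKernel p η := by
  have : 0 < |1 - η| := abs_pos.2 (sub_ne_zero.2 h1.symm)
  refine sub_nonneg.2 (Real.rpow_le_rpow_of_nonpos this ?_ (by linarith))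
  rw [abs_le]
  constructor <;> linarith

lemma diffKernel_le {p η : ℝ} (hp : 0 < p) (hp1 : p < 1) (hη : 2 < η) :
    diffKernel p η ≤ 2 ^ (p + 2) * η ^ (-(p + 1)) := by
  have hpos : 0 < η - 1 := by linarith
  have hη0 : 0 < η := by linarith
  set u : ℝ := 2 / (η - 1) with hu
  have hu0 : 0 < u := by positivity
  have hfac : 1 + η = (η - 1) * (1 + u) := by
    rw [hu]; field_simp; ring
  have hB : (1 + u) ^ p ≤ 1 + p * u :=
    rpow_one_add_le_one_add_mul_self (by linarith) hp.le hp1.le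
  have hB' : 1 - p * u ≤ (1 + u) ^ (-p) := by
    rw [Real.rpow_neg (by positivity)]
    refine le_trans ?_ (inv_anti₀ (by positivity) hB)
    rw [← one_div, le_div_iff₀ (by positivity)]
    nlinarith [sq_nonneg (p * u)]
  have hsplit : diffKernel p η = (η - 1) ^ (-p) * (1 - (1 + u) ^ (-p)) := by
    rw [diffKernel, abs_sub_comm, abs_of_pos hpos, hfac,
      Real.mul_rpow hpos.le (by positivity)]
    ring
  calc diffKernel p η ≤ (η - 1) ^ (-p) * u := by
        rw [hsplit]
        gcongr
        nlinarith
    _ = 2 * (η - 1) ^ (-(p + 1)) := by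
        rw [show -(p + 1) = -p - 1 by ring, Real.rpow_sub_one hpos.ne', hu]
        ring
    _ ≤ 2 * (η / 2) ^ (-(p + 1)) := by
        gcongr 2 * ?_
        exact Real.rpow_le_rpow_of_nonpos (by linarith) (by linarith) (by linarith)
    _ = 2 ^ (p + 2) * η ^ (-(p + 1)) := by
        rw [Real.div_rpow hη0.le zero_le_two, Real.rpow_neg zero_le_two,
          show p + 2 = (p + 1) + 1 by ring, Real.rpow_add_one two_ne_zero (p + 1)]
        field_simp

lemma integrableOn_abs_one_sub_rpow {p : ℝ} (hp1 : p < 1) :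
    IntegrableOn (fun η : ℝ => |1 - η| ^ (-p)) (Ioc 0 2) := by
  have hbase : IntervalIntegrable (fun x : ℝ => x ^ (-p)) volume 0 1 :=
    intervalIntegral.intervalIntegrable_rpow' (by linarith)
  have hl : IntegrableOn (fun η : ℝ => |1 - η| ^ (-p)) (Ioc 0 1) := by
    have h := (hbase.comp_sub_left 1).symm
    rw [sub_self, sub_zero, intervalIntegrable_iff_integrableOn_Ioc_of_le zero_le_one] at h
    refine h.congr_fun (fun η hη => ?_) measurableSet_Ioc
    simp only [abs_of_nonneg (sub_nonneg.2 hη.2)]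
  have hr : IntegrableOn (fun η : ℝ => |1 - η| ^ (-p)) (Ioc 1 2) := by
    have h := hbase.comp_sub_right 1
    rw [zero_add, one_add_one_eq_two,
      intervalIntegrable_iff_integrableOn_Ioc_of_le one_le_two] at h
    refine h.congr_fun (fun η hη => ?_) measurableSet_Ioc
    simp only [abs_sub_comm 1 η, abs_of_pos (sub_pos.2 hη.1)]
  rw [← Ioc_union_Ioc_eq_Ioc zero_le_one one_le_two]
  exact hl.union hr

lemma integrableOn_rpow_mul_diffKernel {p δ : ℝ} (hp : 0 < p) (hp1 : p < 1)
    (hδ : 1 - p < δ) (hδ1 : δ < 1) :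
    IntegrableOn (fun η => η ^ (1 - δ) * diffKernel p η) (Ioi 0) := by
  have hmeas (s : Set ℝ) : AEStronglyMeasurable (fun η => η ^ (1 - δ) * diffKernel p η)
      (volume.restrict s) :=
    ((measurable_id.pow_const _).mul (measurable_diffKernel p)).aestronglyMeasurable
  have hl : IntegrableOn (fun η => η ^ (1 - δ) * diffKernel p η) (Ioc 0 2) := by
    refine Integrable.mono' (((integrableOn_abs_one_sub_rpow hp1).add
      (integrableOn_const (C := (1:ℝ)) (by simp))).const_mul ((2:ℝ) ^ (1 - δ))) (hmeas _) ?_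
    refine (ae_restrict_iff' measurableSet_Ioc).2 (.of_forall fun η hη => ?_)
    have h1 : (1 + η) ^ (-p) ≤ 1 :=
      Real.rpow_le_one_of_one_le_of_nonpos (by linarith [hη.1]) (by linarith)
    have h2 : 0 ≤ (1 + η) ^ (-p) := Real.rpow_nonneg (by linarith [hη.1]) _
    have h3 : 0 ≤ |1 - η| ^ (-p) := by positivity
    rw [norm_mul, Real.norm_of_nonneg (Real.rpow_nonneg hη.1.le _)]
    refine mul_le_mul (Real.rpow_le_rpow hη.1.le hη.2 (by linarith)) ?_ (norm_nonneg _)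
      (by positivity)
    rw [Real.norm_eq_abs, abs_le]
    simp only [diffKernel, Pi.add_apply]
    constructor <;> linarith
  have hr : IntegrableOn (fun η => η ^ (1 - δ) * diffKernel p η) (Ioi 2) := by
    refine Integrable.mono' ((integrableOn_Ioi_rpow_of_lt (a := -(δ + p)) (by linarith)
      (zero_lt_two (α := ℝ))).const_mul (2 ^ (p + 2))) (hmeas _) ?_
    refine (ae_restrict_iff' measurableSet_Ioi).2 (.of_forall fun η (hη : 2 < η) => ?_)
    have h0 : 0 < η := by linarith
    have h1 := diffKernel_nonneg hp h0 (by linarith)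
    rw [Real.norm_of_nonneg (by positivity)]
    calc η ^ (1 - δ) * diffKernel p η
        ≤ η ^ (1 - δ) * (2 ^ (p + 2) * η ^ (-(p + 1))) := by
          gcongr
          exact diffKernel_le hp hp1 hη
      _ = 2 ^ (p + 2) * η ^ (-(δ + p)) := by
          rw [mul_left_comm, ← Real.rpow_add h0]
          ring_nf
  rw [← Ioc_union_Ioi_eq_Ioi zero_le_two]
  exact hl.union hr

section Decay

variable {p δ A : ℝ} {f : ℝ → ℝ}

lemma ae_mul_kernel_bounds (hp : 0 < p) (hf0 : ∀ ξ, 0 < ξ → 0 ≤ f ξ)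
    (hfA : ∀ ξ, 0 < ξ → f ξ ≤ A * ξ ^ (-δ)) {x : ℝ} (hx : 0 < x) :
    ∀ᵐ ξ, ξ ∈ Ioi (0:ℝ) →
      0 ≤ f ξ * (ξ / x * (|x - ξ| ^ (-p) - (x + ξ) ^ (-p))) ∧
      f ξ * (ξ / x * (|x - ξ| ^ (-p) - (x + ξ) ^ (-p))) ≤
        A * x ^ (-(p + δ)) * ((x⁻¹ * ξ) ^ (1 - δ) * diffKernel p (x⁻¹ * ξ)) := by
  filter_upwards [compl_mem_ae_iff.2 (measure_singleton x)] with ξ hξx hξ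
  obtain ⟨η, rfl⟩ : ∃ η, ξ = x * η := ⟨x⁻¹ * ξ, by field_simp⟩
  have hη : 0 < η := pos_of_mul_pos_right (mem_Ioi.1 hξ) hx.le
  have hη1 : η ≠ 1 := by
    rintro rfl
    simp at hξx
  have hk := diffKernel_nonneg hp hη hη1
  have hker : |x - x * η| ^ (-p) - (x + x * η) ^ (-p) = x ^ (-p) * diffKernel p η := by
    rw [show x - x * η = x * (1 - η) by ring, show x + x * η = x * (1 + η) by ring,
      abs_mul, abs_of_pos hx, Real.mul_rpow hx.le (abs_nonneg _),
      Real.mul_rpow hx.le (by positivity), diffKernel]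
    ring
  rw [hker, mul_div_cancel_left₀ _ hx.ne', inv_mul_cancel_left₀ hx.ne']
  have hf := hf0 _ (mem_Ioi.1 hξ)
  refine ⟨by positivity, ?_⟩
  calc f (x * η) * (η * (x ^ (-p) * diffKernel p η))
      ≤ A * (x * η) ^ (-δ) * (η * (x ^ (-p) * diffKernel p η)) := by
        gcongr
        exact hfA _ hξ
    _ = A * x ^ (-(p + δ)) * (η ^ (1 - δ) * diffKernel p η) := by
        rw [Real.mul_rpow hx.le hη.le, neg_add, Real.rpow_add hx, sub_eq_add_neg,
          Real.rpow_add hη, Real.rpow_one]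
        ring

lemma integrableOn_scaled_kernel (hp : 0 < p) (hp1 : p < 1) (hδ : 1 - p < δ) (hδ1 : δ < 1)
    {x : ℝ} (hx : 0 < x) :
    IntegrableOn (fun ξ => A * x ^ (-(p + δ)) *
      ((x⁻¹ * ξ) ^ (1 - δ) * diffKernel p (x⁻¹ * ξ))) (Ioi 0) := by
  refine Integrable.const_mul ?_ _
  have h := (integrableOn_Ioi_comp_mul_left_iff
    (fun η => η ^ (1 - δ) * diffKernel p η) 0 (inv_pos.2 hx)).2
  rw [mul_zero] at h
  exact h (integrableOn_rpow_mul_diffKernel hp hp1 hδ hδ1)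

lemma integrableOn_mul_kernel (hp : 0 < p) (hp1 : p < 1) (hδ : 1 - p < δ) (hδ1 : δ < 1)
    (hf : Continuous f) (hf0 : ∀ ξ, 0 < ξ → 0 ≤ f ξ)
    (hfA : ∀ ξ, 0 < ξ → f ξ ≤ A * ξ ^ (-δ)) {x : ℝ} (hx : 0 < x) :
    IntegrableOn (fun ξ => f ξ * (ξ / x * (|x - ξ| ^ (-p) - (x + ξ) ^ (-p)))) (Ioi 0) := by
  refine Integrable.mono' (integrableOn_scaled_kernel (A := A) hp hp1 hδ hδ1 hx) ?_ ?_
  · have := hf.measurable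
    exact Measurable.aestronglyMeasurable (by fun_prop)
  · refine (ae_restrict_iff' measurableSet_Ioi).2 ?_
    filter_upwards [ae_mul_kernel_bounds hp hf0 hfA hx] with ξ h hξ
    rw [Real.norm_of_nonneg (h hξ).1]
    exact (h hξ).2

lemma integral_mul_kernel_le (hp : 0 < p) (hp1 : p < 1) (hδ : 1 - p < δ) (hδ1 : δ < 1)
    (hf : Continuous f) (hf0 : ∀ ξ, 0 < ξ → 0 ≤ f ξ)
    (hfA : ∀ ξ, 0 < ξ → f ξ ≤ A * ξ ^ (-δ)) {x : ℝ} (hx : 0 < x) :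
    ∫ ξ in Ioi 0, f ξ * (ξ / x * (|x - ξ| ^ (-p) - (x + ξ) ^ (-p))) ≤
      A * (∫ η in Ioi 0, η ^ (1 - δ) * diffKernel p η) * x ^ (-(p + δ - 1)) := by
  calc _ ≤ ∫ ξ in Ioi 0, A * x ^ (-(p + δ)) *
        ((x⁻¹ * ξ) ^ (1 - δ) * diffKernel p (x⁻¹ * ξ)) := by
        refine setIntegral_mono_on_ae
          (integrableOn_mul_kernel hp hp1 hδ hδ1 hf hf0 hfA hx)
          (integrableOn_scaled_kernel hp hp1 hδ hδ1 hx) measurableSet_Ioi ?_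
        filter_upwards [ae_mul_kernel_bounds hp hf0 hfA hx] with ξ h hξ using (h hξ).2
    _ = _ := by
        rw [integral_const_mul, integral_comp_mul_left_Ioi
          (fun η => η ^ (1 - δ) * diffKernel p η) 0 (inv_pos.2 hx), mul_zero, inv_inv,
          smul_eq_mul, show -(p + δ - 1) = -(p + δ) + 1 by ring, Real.rpow_add_one hx.ne']
        ring

lemma integrableOn_mul_rpow_neg (hp1 : p < 1) (hδ : 1 - p < δ)
    (hf : Continuous f) (hf0 : ∀ ξ, 0 < ξ → 0 ≤ f ξ) (hf1 : ∀ ξ, 0 < ξ → f ξ ≤ 1)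
    (hfA : ∀ ξ, 0 < ξ → f ξ ≤ A * ξ ^ (-δ)) :
    IntegrableOn (fun ξ => f ξ * ξ ^ (-p)) (Ioi 0) := by
  have hmeas (s : Set ℝ) : AEStronglyMeasurable (fun ξ => f ξ * ξ ^ (-p))
      (volume.restrict s) :=
    (hf.measurable.mul (measurable_id.pow_const _)).aestronglyMeasurable
  have hnorm (ξ : ℝ) (hξ : 0 < ξ) : ‖f ξ * ξ ^ (-p)‖ = f ξ * ξ ^ (-p) :=
    Real.norm_of_nonneg (mul_nonneg (hf0 ξ hξ) (by positivity))
  have hl : IntegrableOn (fun ξ => f ξ * ξ ^ (-p)) (Ioc 0 1) := by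
    have hbase : IntervalIntegrable (fun x : ℝ => x ^ (-p)) volume 0 1 :=
      intervalIntegral.intervalIntegrable_rpow' (by linarith)
    rw [intervalIntegrable_iff_integrableOn_Ioc_of_le zero_le_one] at hbase
    refine Integrable.mono' hbase (hmeas _) ?_
    refine (ae_restrict_iff' measurableSet_Ioc).2 (.of_forall fun ξ hξ => ?_)
    rw [hnorm ξ hξ.1]
    exact mul_le_of_le_one_left (Real.rpow_nonneg hξ.1.le _) (hf1 ξ hξ.1)
  have hr : IntegrableOn (fun ξ => f ξ * ξ ^ (-p)) (Ioi 1) := by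
    refine Integrable.mono' ((integrableOn_Ioi_rpow_of_lt (a := -δ + -p) (by linarith)
      (zero_lt_one (α := ℝ))).const_mul A) (hmeas _) ?_
    refine (ae_restrict_iff' measurableSet_Ioi).2 (.of_forall fun ξ (hξ : 1 < ξ) => ?_)
    have hξ0 : 0 < ξ := by linarith
    rw [hnorm ξ hξ0, Real.rpow_add hξ0, ← mul_assoc]
    gcongr
    exact hfA ξ hξ0
  rw [← Ioc_union_Ioi_eq_Ioi zero_le_one]
  exact hl.union hr

lemma Tfr_eq_bfr_sub {α x : ℝ} (hα : 0 < α) (hx : 0 < x)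
    (hF : IntegrableOn (fun ξ => f ξ * ξ ^ (-(2*α))) (Ioi 0))
    (hG : IntegrableOn (fun ξ => f ξ *
      (ξ / x * (|x - ξ| ^ (-(2*α)) - (x + ξ) ^ (-(2*α))))) (Ioi 0)) :
    Tfr α f x = bfr α f - C0 α / α *
      ∫ ξ in Ioi 0, f ξ * (ξ / x * (|x - ξ| ^ (-(2*α)) - (x + ξ) ^ (-(2*α)))) := by
  have h : ∫ ξ in Ioi (0:ℝ), f ξ * (4*α * ξ ^ (-(2*α)) -
        (ξ / x) * (|x - ξ| ^ (-(2*α)) - (x + ξ) ^ (-(2*α)))) =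
      4*α * (∫ ξ in Ioi (0:ℝ), f ξ * ξ ^ (-(2*α))) -
        ∫ ξ in Ioi 0, f ξ * (ξ / x * (|x - ξ| ^ (-(2*α)) - (x + ξ) ^ (-(2*α)))) := by
    rw [← integral_const_mul, ← integral_sub (hF.const_mul _) hG]
    congr with ξ
    ring
  rw [Tfr, if_neg hx.ne', abs_of_pos hx, h, bfr]
  field_simp

lemma eventually_Tfr_mem_Ioc {α : ℝ} (hα : α ∈ Ioo (0:ℝ) (1/2)) (hδ : 1 - 2*α < δ)
    (hδ1 : δ < 1) (hf : Continuous f) (hf0 : ∀ ξ, 0 < ξ → 0 ≤ f ξ)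
    (hf1 : ∀ ξ, 0 < ξ → f ξ ≤ 1) (hfA : ∀ ξ, 0 < ξ → f ξ ≤ A * ξ ^ (-δ)) :
    ∀ᶠ x in atTop, Tfr α f x ∈ Ioc (bfr α f - 1) (bfr α f) := by
  have hp : 0 < 2*α := by linarith [hα.1]
  have hp1 : 2*α < 1 := by linarith [hα.2]
  have hC : 0 < C0 α / α := div_pos (C0_pos hα) hα.1
  have hlim := ((tendsto_rpow_neg_atTop (show 0 < 2*α + δ - 1 by linarith)).const_mul
    (A * ∫ η in Ioi 0, η ^ (1 - δ) * diffKernel (2*α) η)).const_mul (C0 α / α)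
  rw [mul_zero, mul_zero] at hlim
  filter_upwards [hlim.eventually_lt_const zero_lt_one, eventually_gt_atTop 0] with x hx1 hx
  rw [Tfr_eq_bfr_sub hα.1 hx (integrableOn_mul_rpow_neg hp1 hδ hf hf0 hf1 hfA)
    (integrableOn_mul_kernel hp hp1 hδ hδ1 hf hf0 hfA hx)]
  have hle := integral_mul_kernel_le hp hp1 hδ hδ1 hf hf0 hfA hx
  have hnn : 0 ≤ ∫ ξ in Ioi 0, f ξ *
      (ξ / x * (|x - ξ| ^ (-(2*α)) - (x + ξ) ^ (-(2*α)))) := by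
    refine setIntegral_nonneg_ae measurableSet_Ioi ?_
    filter_upwards [ae_mul_kernel_bounds hp hf0 hfA hx] with ξ h hξ using (h hξ).1
  have := mul_le_mul_of_nonneg_left hle hC.le
  have := mul_nonneg hC.le hnn
  constructor <;> linarith

end Decay

lemma Rfr_lower_bound {α b R x : ℝ} {f : ℝ → ℝ} (hb : 0 ≤ b) (hR : 1 ≤ R)
    (hT : ∀ y, R ≤ y → Tfr α f y ∈ Ioc (-1) b) (hRR : Rfr α f R ≤ 1) (hx : R ≤ x) :
    Rfr α f R * x ^ (-(b / (1 + b))) ≤ Rfr α f x := by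
  have hR0 : 0 < R := by linarith
  have hx0 : 0 < x := by linarith
  have hβ : 0 ≤ b / (1 + b) := by positivity
  have hxβ : x ^ (-(b / (1 + b))) ≤ 1 :=
    Real.rpow_le_one_of_one_le_of_nonpos (by linarith) (by linarith)
  have hRpos : 0 < Rfr α f R := Real.exp_pos _
  by_cases hint : IntervalIntegrable (fun y => Tfr α f y / (y * (1 + Tfr α f y))) volume 0 x
  · have h0R := hint.mono_set (uIcc_subset_uIcc_left (mem_uIcc_of_le hR0.le hx))
    have hRx := hint.mono_set (uIcc_subset_uIcc_right (mem_uIcc_of_le hR0.le hx))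
    have hbd : IntervalIntegrable (fun y : ℝ => b / (1 + b) * (1 / y)) volume R x := by
      refine (intervalIntegral.intervalIntegrable_one_div (fun y hy => ?_)
        continuousOn_id).const_mul _
      rw [uIcc_of_le hx] at hy
      exact (hR0.trans_le hy.1).ne'
    have hle : ∫ y in R..x, Tfr α f y / (y * (1 + Tfr α f y)) ≤
        b / (1 + b) * Real.log (x / R) := by
      rw [← integral_one_div_of_pos hR0 hx0, ← intervalIntegral.integral_const_mul]
      refine intervalIntegral.integral_mono_on hx hRx hbd fun y hy => ?_
      have hy0 : 0 < y := hR0.trans_le hy.1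
      obtain ⟨h1, h2⟩ := hT y hy.1
      have h3 : 0 < 1 + Tfr α f y := by linarith
      rw [mul_one_div, div_div, div_le_div_iff₀ (by positivity) (by positivity)]
      nlinarith
    have hlog : Real.log (x / R) ≤ Real.log x :=
      Real.log_le_log (by positivity) (div_le_self hx0.le hR)
    have hle' := hle.trans (mul_le_mul_of_nonneg_left hlog hβ)
    rw [Rfr, Rfr, abs_of_pos hR0, abs_of_pos hx0, Real.rpow_def_of_pos hx0, ← Real.exp_add,
      ← intervalIntegral.integral_add_adjacent_intervals h0R hRx]
    refine Real.exp_le_exp.2 ?_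
    linarith
  · have : Rfr α f x = 1 := by
      rw [Rfr, abs_of_pos hx0, intervalIntegral.integral_undef hint, neg_zero, Real.exp_zero]
    rw [this]
    exact mul_le_one₀ hRR (by positivity) hxβ

/-- Any fixed point `f ∈ 𝒲₁` of `ℜ_α` satisfies `𝔟(f) > 1/(2α) - 1`;
equivalently the scaling parameter `c_ℓ = 1 + 𝔟(f)` satisfies `2α c_ℓ - 1 > 0`,
so the fixed point corresponds to a focusing-type self-similar blow-up. -/
theorem fixed_point_focusing (α t0 δl : ℝ) (hα : α ∈ Ioo (0:ℝ) (1/2)) (ht0 : 1 < t0)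
    (ht1 : max (1 / C3 α) ((1 - 2*α) / (2*α * C3 α)) < t0 ^ (1/2 - α))
    (ht2 : (2:ℝ) ^ ((2:ℝ) ^ α + 2) * Real.Gamma (2 + α) * Real.Gamma (1/2 - α) /
        (3*π*α*Real.Gamma (1 - α)) < t0 ^ (1/2 + α))
    (hδl : 1/2 ≤ δl)
    (hδ1 : (2:ℝ) ^ (2*α) * Real.Gamma (2 + α) * Real.Gamma (1/2 - α) /
        (3*π*Real.Gamma (1 - α)) ≤
        Real.Gamma (δl + 1) * t0 ^ (2*α - 1) / Real.Gamma (δl + α + 1/2))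
    (hδ2 : Real.Gamma (δl + 1) * t0 ^ (2*α - 1) / Real.Gamma (δl + α + 1/2) ≤
        (2:ℝ) ^ (2*α + 1) * Real.Gamma (2 + α) * Real.Gamma (1/2 - α) /
        (3*π*Real.Gamma (1 - α)))
    (f : ℝ → ℝ) (hf : W1 α t0 δl f) (hfix : ∀ x : ℝ, Rfr α f x = f x) :
    1/(2*α) - 1 < bfr α f ∧ 0 < 2*α*(1 + bfr α f) - 1 := by
  obtain ⟨hcont, -, -, -, hnn, -, -, -, hfu, -⟩ := hf
  obtain ⟨hδ, hδ'⟩ := deltaU_mem_Ioo hα ht0 ((le_max_right _ _).trans_lt ht1)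
  have hα0 := hα.1
  have hf0 : ∀ ξ, 0 < ξ → 0 ≤ f ξ := fun ξ hξ => hnn ξ hξ.le
  have hf1 : ∀ ξ, 0 < ξ → f ξ ≤ 1 := fun ξ hξ => by
    have h := hfu ξ
    rw [fu, if_neg hξ.ne'] at h
    exact h.trans (min_le_left _ _)
  have hfA : ∀ ξ, 0 < ξ → f ξ ≤ t0 ^ deltaU α t0 * ξ ^ (-deltaU α t0) := fun ξ hξ => by
    have h := hfu ξ
    rw [fu, if_neg hξ.ne', abs_of_pos hξ] at h
    exact h.trans (min_le_right _ _)
  have hF := integrableOn_mul_rpow_neg (p := 2*α) (by linarith [hα.2]) hδ hcont hf0 hf1 hfA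
  have hb : 0 ≤ bfr α f := by
    refine mul_nonneg (mul_nonneg zero_le_four (C0_pos hα).le)
      (setIntegral_nonneg measurableSet_Ioi fun ξ hξ => ?_)
    exact mul_nonneg (hf0 ξ hξ) (Real.rpow_nonneg (le_of_lt hξ) _)
  obtain ⟨R, hR'⟩ := eventually_atTop.1 ((eventually_ge_atTop 1).and
    (eventually_Tfr_mem_Ioc hα hδ hδ' hcont hf0 hf1 hfA))
  have hR1 : 1 ≤ R := (hR' R le_rfl).1
  have hR : ∀ y, R ≤ y → Tfr α f y ∈ Ioc (bfr α f - 1) (bfr α f) := fun y hy => (hR' y hy).2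
  have hR0 : 0 < R := by linarith
  have hfR : 0 < f R := hfix R ▸ Real.exp_pos _
  have hlow : ∀ x, R ≤ x → f R * x ^ (-(bfr α f / (1 + bfr α f))) ≤ f x := fun x hx => by
    rw [← hfix R, ← hfix x]
    refine Rfr_lower_bound hb hR1 (fun y hy => ⟨?_, (hR y hy).2⟩)
      ((hfix R).trans_le (hf1 R hR0)) hx
    linarith [(hR y hy).1]
  have hpow : IntegrableOn
      (fun x : ℝ => x ^ (-(bfr α f / (1 + bfr α f)) + -(2*α))) (Ioi R) := by
    refine Integrable.mono' ((hF.mono_set (Ioi_subset_Ioi hR0.le)).const_mul (f R)⁻¹)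
      (measurable_id.pow_const _).aestronglyMeasurable ?_
    refine (ae_restrict_iff' measurableSet_Ioi).2 (.of_forall fun x (hx : R < x) => ?_)
    have hx0 : 0 < x := hR0.trans hx
    rw [Real.norm_of_nonneg (by positivity), Real.rpow_add hx0, ← mul_assoc]
    gcongr
    rw [le_inv_mul_iff₀ hfR]
    exact hlow x hx.le
  have hexp := (integrableOn_Ioi_rpow_iff hR0).1 hpow
  have hfrac : 1 - 2*α < bfr α f / (1 + bfr α f) := by linarith
  rw [lt_div_iff₀ (by linarith)] at hfrac
  have hfinal : 0 < 2*α*(1 + bfr α f) - 1 := by linarith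
  refine ⟨?_, hfinal⟩
  rw [sub_lt_iff_lt_add, div_lt_iff₀ (by linarith)]
  linarith

end GSQGhalfplane
end
end
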